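/- arXiv:1707.00274 — 3 statements merged into one kernel-verified Lean document; each statement's English description precedes it below -/
import Mathlib

section
/- Let X be a real inner product space and let 0 ≤ γ ≤ 1. Then for all x, x' ∈ X the parallelogram inequality ‖x + x'‖^{2γ} + ‖x − x'‖^{2γ} ≤ 2‖x‖^{2γ} + 2‖x'‖^{2γ} holds (with equality for all x, x' when γ = 1). -/
/-- Midpoint concavity and subadditivity of `r ↦ r ^ γ`, combined. -/
lemma Real.rpow_add_rpow_le_of_add_eq_two_mul {γ : ℝ} (h0 : 0 ≤ γ) (h1 : γ ≤ 1) {s t a b : ℝ}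
    (hs : 0 ≤ s) (ht : 0 ≤ t) (ha : 0 ≤ a) (hb : 0 ≤ b) (h : s + t = 2 * (a + b)) :
    s ^ γ + t ^ γ ≤ 2 * a ^ γ + 2 * b ^ γ := by
  have hconc := (Real.concaveOn_rpow h0 h1).2 (Set.mem_Ici.2 hs) (Set.mem_Ici.2 ht)
    (show (0 : ℝ) ≤ 1 / 2 by norm_num) (show (0 : ℝ) ≤ 1 / 2 by norm_num) (by norm_num)
  have hmid : (1 / 2 : ℝ) * s + 1 / 2 * t = a + b := by linarith
  simp only [smul_eq_mul, hmid] at hconc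
  have hsub := Real.rpow_add_le_add_rpow ha hb h0 h1
  linarith

/-- Parallelogram inequality: in a real inner product space, for `0 ≤ γ ≤ 1`,
`‖x + x'‖^(2γ) + ‖x - x'‖^(2γ) ≤ 2‖x‖^(2γ) + 2‖x'‖^(2γ)`, with equality when `γ = 1`. -/
theorem stmt_7 {X : Type*} [NormedAddCommGroup X] [InnerProductSpace ℝ X]
    {γ : ℝ} (h0 : 0 ≤ γ) (h1 : γ ≤ 1) (x x' : X) :
    ‖x + x'‖ ^ (2 * γ) + ‖x - x'‖ ^ (2 * γ) ≤
      2 * ‖x‖ ^ (2 * γ) + 2 * ‖x'‖ ^ (2 * γ) ∧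
    (γ = 1 →
      ‖x + x'‖ ^ (2 * γ) + ‖x - x'‖ ^ (2 * γ) =
        2 * ‖x‖ ^ (2 * γ) + 2 * ‖x'‖ ^ (2 * γ)) := by
  have hpar : ‖x + x'‖ ^ 2 + ‖x - x'‖ ^ 2 = 2 * (‖x‖ ^ 2 + ‖x'‖ ^ 2) := by
    simpa only [sq] using parallelogram_law_with_norm ℝ x x'
  have hpow (y : X) : ‖y‖ ^ (2 * γ) = (‖y‖ ^ 2) ^ γ := by
    rw [Real.rpow_mul (norm_nonneg y), Real.rpow_two]
  simp only [hpow]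
  refine ⟨Real.rpow_add_rpow_le_of_add_eq_two_mul h0 h1 (sq_nonneg _) (sq_nonneg _)
    (sq_nonneg _) (sq_nonneg _) hpar, ?_⟩
  rintro rfl
  simp only [Real.rpow_one]
  linarith
end

section
/- Let X be a real inner product space, let 0 < γ ≤ 1/2, and let h_γ(x, x') = −(1/2)(‖x − x'‖^{2γ} − ‖x‖^{2γ} − ‖x'‖^{2γ}) be the FBM-γ kernel. Then for every x₀ ∈ X the function x ↦ h_γ(x₀, x) is Hölder of order 2γ with constant 1: for all x, x' ∈ X, |h_γ(x₀, x) − h_γ(x₀, x')| ≤ ‖x − x'‖^{2γ}. -/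
theorem norm_rpow_le_norm_rpow_add_norm_sub_rpow {E : Type*} [SeminormedAddCommGroup E] {p : ℝ}
    (hp : 0 ≤ p) (hp1 : p ≤ 1) (a b : E) : ‖a‖ ^ p ≤ ‖b‖ ^ p + ‖a - b‖ ^ p :=
  calc ‖a‖ ^ p ≤ (‖b‖ + ‖a - b‖) ^ p :=
        Real.rpow_le_rpow (norm_nonneg a) (norm_le_norm_add_norm_sub' a b) hp
    _ ≤ ‖b‖ ^ p + ‖a - b‖ ^ p :=
        Real.rpow_add_le_add_rpow (norm_nonneg b) (norm_nonneg _) hp hp1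

/-- Snowflake version of the reverse triangle inequality. -/
theorem abs_norm_rpow_sub_norm_rpow_le {E : Type*} [SeminormedAddCommGroup E] {p : ℝ}
    (hp : 0 ≤ p) (hp1 : p ≤ 1) (a b : E) : |‖a‖ ^ p - ‖b‖ ^ p| ≤ ‖a - b‖ ^ p := by
  have hab := norm_rpow_le_norm_rpow_add_norm_sub_rpow hp hp1 a b
  have hba := norm_rpow_le_norm_rpow_add_norm_sub_rpow hp hp1 b a
  rw [norm_sub_rev b a] at hba
  rw [abs_le]
  constructor <;> linarith

/-- For `0 < γ ≤ 1/2`, the FBM-γ kernel section `x ↦ h_γ(x₀, x)` is Hölder of order `2γ`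
with constant 1. -/
theorem stmt_8 {X : Type*} [NormedAddCommGroup X] [InnerProductSpace ℝ X]
    {γ : ℝ} (hγ0 : 0 < γ) (hγ1 : γ ≤ 1/2)
    (hγfun : X → X → ℝ)
    (hdef : ∀ a b : X, hγfun a b =
      -(1/2) * (‖a - b‖ ^ (2 * γ) - ‖a‖ ^ (2 * γ) - ‖b‖ ^ (2 * γ)))
    (x₀ : X) :
    ∀ x x' : X, |hγfun x₀ x - hγfun x₀ x'| ≤ ‖x - x'‖ ^ (2 * γ) := by
  intro x x'
  have hp : 0 ≤ 2 * γ := by linarith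
  have hp1 : 2 * γ ≤ 1 := by linarith
  have hnorm := abs_le.mp (abs_norm_rpow_sub_norm_rpow_le hp hp1 x x')
  have hdist := abs_le.mp (abs_norm_rpow_sub_norm_rpow_le hp hp1 (x₀ - x) (x₀ - x'))
  rw [sub_sub_sub_cancel_left, norm_sub_rev x' x] at hdist
  rw [hdef, hdef, abs_le]
  constructor <;> linarith [hnorm.1, hnorm.2, hdist.1, hdist.2]
end

section
/- Let X be a real inner product space, let 1/2 < γ < 1, and let h_γ(x, x') = −(1/2)(‖x − x'‖^{2γ} − ‖x‖^{2γ} − ‖x'‖^{2γ}) be the FBM-γ kernel. Then for every x₀ ∈ X the function x ↦ h_γ(x₀, x) is Hölder of order 2γ (in the second-difference sense) with constant 1: for all x, t ∈ X, |h_γ(x₀, x − t) − 2 h_γ(x₀, x) + h_γ(x₀, x + t)| ≤ ‖t‖^{2γ}. -/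
/-- The second difference of `‖·‖ ^ p` is nonnegative for `1 ≤ p`. -/
theorem two_mul_norm_rpow_le {E : Type*} [SeminormedAddCommGroup E] [NormedSpace ℝ E]
    {p : ℝ} (hp : 1 ≤ p) (x t : E) :
    2 * ‖x‖ ^ p ≤ ‖x + t‖ ^ p + ‖x - t‖ ^ p := by
  have hnorm : ‖x‖ ≤ 1 / 2 * ‖x + t‖ + 1 / 2 * ‖x - t‖ := by
    have h := norm_add_le (x + t) (x - t)
    rw [show x + t + (x - t) = (2 : ℝ) • x by rw [two_smul]; abel, norm_smul] at h
    norm_num at h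
    linarith
  have hmono : ‖x‖ ^ p ≤ (1 / 2 * ‖x + t‖ + 1 / 2 * ‖x - t‖) ^ p := by gcongr
  have hconv := (convexOn_rpow hp).2 (Set.mem_Ici.2 (norm_nonneg (x + t)))
    (Set.mem_Ici.2 (norm_nonneg (x - t)))
    (by norm_num : (0 : ℝ) ≤ 1 / 2) (by norm_num : (0 : ℝ) ≤ 1 / 2) (by norm_num)
  simp only [smul_eq_mul] at hconv
  linarith

/-- In an inner product space, the second difference of `‖·‖ ^ (2 * γ)` in direction `t` is at most
`2 * ‖t‖ ^ (2 * γ)` for `0 ≤ γ ≤ 1`. -/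
theorem norm_add_rpow_add_norm_sub_rpow_le {E : Type*} [SeminormedAddCommGroup E]
    [InnerProductSpace ℝ E] {γ : ℝ} (hγ0 : 0 ≤ γ) (hγ1 : γ ≤ 1) (x t : E) :
    ‖x + t‖ ^ (2 * γ) + ‖x - t‖ ^ (2 * γ) ≤ 2 * ‖x‖ ^ (2 * γ) + 2 * ‖t‖ ^ (2 * γ) := by
  have hpow (y : E) : ‖y‖ ^ (2 * γ) = (‖y‖ ^ 2) ^ γ := by
    rw [Real.rpow_mul (norm_nonneg y), Real.rpow_two]
  simp only [hpow]
  have hconc := (Real.concaveOn_rpow hγ0 hγ1).2 (Set.mem_Ici.2 (sq_nonneg ‖x + t‖))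
    (Set.mem_Ici.2 (sq_nonneg ‖x - t‖))
    (by norm_num : (0 : ℝ) ≤ 1 / 2) (by norm_num : (0 : ℝ) ≤ 1 / 2) (by norm_num)
  have hpar : 1 / 2 * ‖x + t‖ ^ 2 + 1 / 2 * ‖x - t‖ ^ 2 = ‖x‖ ^ 2 + ‖t‖ ^ 2 := by
    linarith [parallelogram_law_with_norm ℝ x t]
  simp only [smul_eq_mul, hpar] at hconc
  have hsub := Real.rpow_add_le_add_rpow (sq_nonneg ‖x‖) (sq_nonneg ‖t‖) hγ0 hγ1
  linarith

/-- For `1/2 < γ < 1`, the FBM-γ kernel section `x ↦ h_γ(x₀, x)` is Hölder of order `2γ`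
in the second-difference sense with constant 1. -/
theorem stmt_9 {X : Type*} [NormedAddCommGroup X] [InnerProductSpace ℝ X]
    {γ : ℝ} (hγ0 : 1/2 < γ) (hγ1 : γ < 1)
    (hγfun : X → X → ℝ)
    (hdef : ∀ a b : X, hγfun a b =
      -(1/2) * (‖a - b‖ ^ (2 * γ) - ‖a‖ ^ (2 * γ) - ‖b‖ ^ (2 * γ)))
    (x₀ : X) :
    ∀ x t : X, |hγfun x₀ (x - t) - 2 * hγfun x₀ x + hγfun x₀ (x + t)| ≤ ‖t‖ ^ (2 * γ) := by
  intro x t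
  have hx := two_mul_norm_rpow_le (by linarith : 1 ≤ 2 * γ) x t
  have hx' := norm_add_rpow_add_norm_sub_rpow_le (by linarith) hγ1.le x t
  have hy := two_mul_norm_rpow_le (by linarith : 1 ≤ 2 * γ) (x₀ - x) t
  have hy' := norm_add_rpow_add_norm_sub_rpow_le (by linarith) hγ1.le (x₀ - x) t
  have hsub : x₀ - (x - t) = x₀ - x + t := by abel
  have hadd : x₀ - (x + t) = x₀ - x - t := by abel
  rw [hdef, hdef, hdef, hsub, hadd, abs_le]
  constructor <;> linarith
end
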